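/- (Lemma A.2.) Let X be a p-variate Gaussian vector with mean zero and covariance Σ ∈ U_τ(q, c₀, M), let V be a symmetric p×p matrix with ‖V‖_F = 1, and let Σ̂⁰₁ = X Xᵀ. Write Σ = P Λ Pᵀ for the eigendecomposition of Σ and let γ₁, …, γ_p (ordered by |γ₁| ≥ |γ₂| ≥ …) be the eigenvalues of S = Λ^{1/2} Pᵀ V P Λ^{1/2}. Then tr(V Σ̂⁰₁) is distributed as Σ_{j=1}^p γ_j Z_j² with Z₁, …, Z_p i.i.d. standard normal, and there exist constants K = K(q, c₀, M) > 0 and δ = δ(q, c₀, M) > 0 such that P[p^{−1/2} |tr(V Σ̂⁰₁) − Σ_{j=1}^p γ_j| ≥ t] ≤ K e^{−δ t (1 + o(1))} as t → ∞. -/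

import Mathlib

open MeasureTheory ProbabilityTheory Matrix Filter
open scoped ENNReal NNReal BigOperators

/-- `|x|^q`, with the convention `0^0 = 0` (so for `q = 0` this is the indicator of `x ≠ 0`). -/
noncomputable def absPow (q x : ℝ) : ℝ := if x = 0 then 0 else |x| ^ q

/-- Membership in the uniformity class `U_τ(q, c₀, M)`. -/
def memUtau {p : ℕ} (q c0 M : ℝ) (S : Matrix (Fin p) (Fin p) ℝ) : Prop :=
  (∀ i, S i i ≤ M) ∧ ∀ i, ∑ j, absPow q (S i j) ≤ c0

/-- `X` is a `p`-variate Gaussian vector with mean `m` and covariance matrix `S`. -/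
def IsGaussianVec {p : ℕ} {Ω : Type} [MeasurableSpace Ω] (μ : Measure Ω)
    (X : Ω → Fin p → ℝ) (m : Fin p → ℝ) (S : Matrix (Fin p) (Fin p) ℝ) : Prop :=
  Measurable X ∧ ∀ a : Fin p → ℝ,
    Measure.map (fun ω => ∑ i, a i * X ω i) μ =
      gaussianReal (∑ i, a i * m i) (Real.toNNReal (∑ i, ∑ j, a i * S i j * a j))

lemma aux_exp_bound {u : ℝ} (hu : |u| ≤ 1 / 2) : 1 ≤ (1 - u) * Real.exp (u + u ^ 2) := by
  obtain ⟨h1, h2⟩ := abs_le.mp hu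
  rcases le_total 0 u with h | h
  · have h3 := Real.quadratic_le_exp_of_nonneg (x := u + u ^ 2) (by positivity)
    have h4 : (1 - u) * (1 + (u + u ^ 2) + (u + u ^ 2) ^ 2 / 2) ≤
        (1 - u) * Real.exp (u + u ^ 2) := mul_le_mul_of_nonneg_left h3 (by linarith)
    have h5 : 2 * u ≤ (1 - u) * (1 + u) ^ 2 := by
      nlinarith [mul_nonneg h (sub_nonneg.mpr h2), mul_nonneg (mul_nonneg h h) (sub_nonneg.mpr h2)]
    have h6 : 0 ≤ u ^ 2 * ((1 - u) * (1 + u) ^ 2 - 2 * u) :=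
      mul_nonneg (sq_nonneg u) (by linarith)
    nlinarith [h4, h6]
  · have h3 := Real.add_one_le_exp (u + u ^ 2)
    have h4 : (1 - u) * (u + u ^ 2 + 1) ≤
        (1 - u) * Real.exp (u + u ^ 2) := mul_le_mul_of_nonneg_left h3 (by linarith)
    nlinarith [mul_nonneg (neg_nonneg.mpr h) (sq_nonneg u)]

lemma aux_chi {x : ℝ} (hx : |x| ≤ 1 / 4) :
    Integrable (fun z : ℝ => Real.exp (x * (z ^ 2 - 1))) (gaussianReal 0 1) ∧
    ∫ z, Real.exp (x * (z ^ 2 - 1)) ∂(gaussianReal 0 1) ≤ Real.exp (2 * x ^ 2) := by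
  obtain ⟨hx1, hx2⟩ := abs_le.mp hx
  have hb : 0 < 1 / 2 - x := by linarith
  have hfun : (fun z : ℝ => gaussianPDFReal 0 1 z • Real.exp (x * (z ^ 2 - 1))) =
      fun z => ((√(2 * Real.pi))⁻¹ * Real.exp (-x)) * Real.exp (-(1 / 2 - x) * z ^ 2) := by
    funext z
    simp only [gaussianPDFReal, smul_eq_mul, NNReal.coe_one, mul_one, sub_zero]
    rw [mul_assoc, mul_assoc, ← Real.exp_add, ← Real.exp_add]
    congr 2
    ring
  constructor
  · rw [gaussianReal_of_var_ne_zero _ one_ne_zero, integrable_withDensity_iff_integrable_smul'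
      (measurable_gaussianPDF 0 1) (Filter.Eventually.of_forall fun _ => gaussianPDF_lt_top)]
    simp only [toReal_gaussianPDF]
    rw [hfun]
    exact (integrable_exp_neg_mul_sq hb).const_mul _
  · rw [integral_gaussianReal_eq_integral_smul one_ne_zero, hfun, integral_const_mul,
      integral_gaussian]
    have key := aux_exp_bound (u := 2 * x) (by rw [abs_le]; constructor <;> linarith)
    have h1 : (0 : ℝ) < 1 - 2 * x := by linarith
    have e1 : (√(2 * Real.pi))⁻¹ * Real.exp (-x) * √(Real.pi / (1 / 2 - x))
        = √((1 - 2 * x)⁻¹) * Real.exp (-x) := by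
      have : Real.pi / (1 / 2 - x) = (2 * Real.pi) * (1 - 2 * x)⁻¹ := by
        field_simp
      rw [this, Real.sqrt_mul (x := 2 * Real.pi) (by positivity) ((1 - 2 * x)⁻¹)]
      have : √(2 * Real.pi) ≠ 0 := by positivity
      generalize √(2 * Real.pi) = y at this
      generalize √((1 - 2 * x)⁻¹) = w
      field_simp
    rw [e1]
    have e2 : (1 - 2 * x)⁻¹ ≤ Real.exp (x + 2 * x ^ 2) ^ 2 := by
      rw [inv_le_iff_one_le_mul₀' h1, ← Real.exp_nat_mul]
      have e : ((2 : ℕ) : ℝ) * (x + 2 * x ^ 2) = 2 * x + (2 * x) ^ 2 := by push_cast; ring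
      rw [e]
      exact key
    have e3 : √((1 - 2 * x)⁻¹) ≤ Real.exp (x + 2 * x ^ 2) := Real.sqrt_le_iff.mpr ⟨by positivity, e2⟩
    calc _ ≤ Real.exp (x + 2 * x ^ 2) * Real.exp (-x) := by gcongr
      _ = _ := by rw [← Real.exp_add]; congr 1; ring

lemma aux_tail_one {p : ℕ} (γ : Fin p → ℝ) {B : ℝ} (hB : 0 < B) (hγ : ∑ j, γ j ^ 2 ≤ B ^ 2)
    (r : ℝ) :
    (Measure.pi fun _ : Fin p => gaussianReal 0 1)
      {z | r ≤ ∑ j, γ j * (z j) ^ 2 - ∑ j, γ j} ≤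
    ENNReal.ofReal (Real.exp 1 * Real.exp (-(1 / (4 * B)) * r)) := by
  set s : ℝ := 1 / (4 * B) with hs
  have hs0 : 0 < s := by positivity
  have hsB : s * B = 1 / 4 := by rw [hs]; field_simp
  have hj : ∀ j, |s * γ j| ≤ 1 / 4 := by
    intro j
    rw [abs_mul, abs_of_pos hs0, ← hsB]
    gcongr
    refine abs_le_of_sq_le_sq ?_ hB.le
    exact (Finset.single_le_sum (f := fun j => γ j ^ 2) (fun i _ => sq_nonneg _)
      (Finset.mem_univ j)).trans hγ
  have hprod : (fun z : Fin p → ℝ => Real.exp (s * (∑ j, γ j * (z j) ^ 2 - ∑ j, γ j))) =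
      fun z => ∏ j, Real.exp (s * γ j * ((z j) ^ 2 - 1)) := by
    funext z
    rw [← Real.exp_sum, ← Finset.sum_sub_distrib, Finset.mul_sum]
    congr 1
    exact Finset.sum_congr rfl fun j _ => by ring
  have hintegr : Integrable (fun z : Fin p → ℝ => Real.exp (s * (∑ j, γ j * (z j) ^ 2 - ∑ j, γ j)))
      (Measure.pi fun _ : Fin p => gaussianReal 0 1) := by
    rw [hprod]
    exact Integrable.fintype_prod (f := fun j x => Real.exp (s * γ j * (x ^ 2 - 1)))
      (fun j => (aux_chi (hj j)).1)
  have hmgf : mgf (fun z : Fin p → ℝ => ∑ j, γ j * (z j) ^ 2 - ∑ j, γ j)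
      (Measure.pi fun _ : Fin p => gaussianReal 0 1) s ≤ Real.exp 1 := by
    rw [mgf, hprod, integral_fintype_prod_eq_prod (fun j x => Real.exp (s * γ j * (x ^ 2 - 1)))]
    calc _ ≤ ∏ j, Real.exp (2 * (s * γ j) ^ 2) :=
          Finset.prod_le_prod (fun j _ => integral_nonneg fun _ => (Real.exp_pos _).le)
            (fun j _ => (aux_chi (hj j)).2)
      _ = Real.exp (2 * s ^ 2 * ∑ j, γ j ^ 2) := by
          rw [← Real.exp_sum, Finset.mul_sum]
          congr 1
          exact Finset.sum_congr rfl fun j _ => by ring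
      _ ≤ Real.exp 1 := by
          apply Real.exp_le_exp.mpr
          calc 2 * s ^ 2 * ∑ j, γ j ^ 2 ≤ 2 * s ^ 2 * B ^ 2 := by gcongr
            _ = 2 * (s * B) ^ 2 := by ring
            _ ≤ 1 := by rw [hsB]; norm_num
  have := measure_ge_le_exp_mul_mgf (μ := Measure.pi fun _ : Fin p => gaussianReal 0 1)
    (X := fun z : Fin p → ℝ => ∑ j, γ j * (z j) ^ 2 - ∑ j, γ j) r hs0.le hintegr
  rw [← ENNReal.ofReal_toReal (measure_ne_top (Measure.pi fun _ : Fin p => gaussianReal 0 1)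
    {z | r ≤ ∑ j, γ j * (z j) ^ 2 - ∑ j, γ j})]
  apply ENNReal.ofReal_le_ofReal
  refine this.trans ?_
  rw [mul_comm]
  gcongr

lemma aux_tail {p : ℕ} (γ : Fin p → ℝ) {B : ℝ} (hB : 0 < B) (hγ : ∑ j, γ j ^ 2 ≤ B ^ 2)
    (r : ℝ) :
    (Measure.pi fun _ : Fin p => gaussianReal 0 1)
      {z | r ≤ |∑ j, γ j * (z j) ^ 2 - ∑ j, γ j|} ≤
    ENNReal.ofReal (2 * Real.exp 1 * Real.exp (-(1 / (4 * B)) * r)) := by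
  have h1 := aux_tail_one γ hB hγ r
  have h2 := aux_tail_one (fun j => - γ j) hB (by simpa using hγ) r
  calc _ ≤ (Measure.pi fun _ : Fin p => gaussianReal 0 1)
        ({z | r ≤ ∑ j, γ j * (z j) ^ 2 - ∑ j, γ j} ∪
          {z | r ≤ ∑ j, -γ j * (z j) ^ 2 - ∑ j, -γ j}) := by
        apply measure_mono
        intro z hz
        simp only [Set.mem_ofPred_eq, Set.mem_union, neg_mul, Finset.sum_neg_distrib] at hz ⊢
        rcases le_abs.mp hz with h | h
        · left; exact h
        · right; linarith
    _ ≤ _ := measure_union_le _ _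
    _ ≤ _ := add_le_add h1 h2
    _ = _ := by
        rw [← ENNReal.ofReal_add (by positivity) (by positivity)]
        congr 1; ring

lemma aux_abs_le {p : ℕ} {M : ℝ} {S : Matrix (Fin p) (Fin p) ℝ} (hS : S.PosSemidef)
    (hd : ∀ i, S i i ≤ M) (i j : Fin p) : |S i j| ≤ M := by
  have hsym : S j i = S i j := by simpa using hS.1.apply i j
  have h1 := hS.dotProduct_mulVec_nonneg (Pi.single i 1 + Pi.single j 1)
  have h2 := hS.dotProduct_mulVec_nonneg (Pi.single i 1 - Pi.single j 1)
  simp [Matrix.mulVec_add, Matrix.mulVec_sub, add_dotProduct, sub_dotProduct, hsym] at h1 h2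
  have := hd i
  have := hd j
  rw [abs_le]
  constructor <;> linarith

lemma aux_rowsum {p : ℕ} {q c0 M : ℝ} (hq1 : q < 1) {S : Matrix (Fin p) (Fin p) ℝ}
    (hS : S.PosSemidef) (hU : memUtau q c0 M S) (i : Fin p) :
    ∑ j, |S i j| ≤ M ^ (1 - q) * c0 := by
  have hM : 0 ≤ M := (abs_nonneg _).trans (aux_abs_le hS hU.1 i i)
  calc ∑ j, |S i j| ≤ ∑ j, M ^ (1 - q) * absPow q (S i j) := by
        apply Finset.sum_le_sum
        intro j _
        unfold absPow
        split_ifs with h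
        · simp [h]
        · have hp : 0 < |S i j| := abs_pos.mpr h
          calc |S i j| = |S i j| ^ (1 - q) * |S i j| ^ q := by
                rw [← Real.rpow_add hp]; simp
            _ ≤ _ := by
                apply mul_le_mul_of_nonneg_right _ (by positivity)
                exact Real.rpow_le_rpow hp.le (aux_abs_le hS hU.1 i j) (by linarith)
    _ = M ^ (1 - q) * ∑ j, absPow q (S i j) := by rw [Finset.mul_sum]
    _ ≤ _ := by
        gcongr
        exact hU.2 i

lemma aux_eig {p : ℕ} {B : ℝ} {S P : Matrix (Fin p) (Fin p) ℝ} {d : Fin p → ℝ}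
    (hrow : ∀ i, ∑ j, |S i j| ≤ B) (hP : P * Pᵀ = 1) (hSP : S = P * Matrix.diagonal d * Pᵀ)
    (i : Fin p) : d i ≤ B := by
  have hP' : Pᵀ * P = 1 := mul_eq_one_comm.mp hP
  have hev : Module.End.HasEigenvalue (Matrix.toLin' S) (d i) := by
    apply Module.End.hasEigenvalue_of_hasEigenvector (x := P *ᵥ Pi.single i 1)
    rw [Module.End.hasEigenvector_iff, Module.End.mem_eigenspace_iff]
    constructor
    · rw [Matrix.toLin'_apply, hSP, Matrix.mulVec_mulVec, Matrix.mul_assoc, hP', Matrix.mul_one,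
        ← Matrix.mulVec_mulVec, ← Matrix.mulVec_smul]
      congr 1
      ext k
      simp [Matrix.mulVec_diagonal, Pi.single_apply]
      split_ifs with hk
      · rw [hk]
      · rfl
    · intro h0
      have : Pᵀ *ᵥ (P *ᵥ Pi.single i 1) = 0 := by rw [h0, Matrix.mulVec_zero]
      rw [Matrix.mulVec_mulVec, hP', Matrix.one_mulVec] at this
      have := congrFun this i
      simp at this
  obtain ⟨k, hk⟩ := eigenvalue_mem_ball hev
  rw [Metric.mem_closedBall, Real.dist_eq] at hk
  have h1 := (abs_le.mp hk).2
  have h2 := Finset.add_sum_erase Finset.univ (fun j => |S k j|) (Finset.mem_univ k)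
  simp only [Real.norm_eq_abs] at h1
  have := hrow k
  have := le_abs_self (S k k)
  linarith

lemma aux_frob {p : ℕ} (N : Matrix (Fin p) (Fin p) ℝ) :
    (N * Nᵀ).trace = ∑ a, ∑ b, (N a b) ^ 2 := by
  simp [Matrix.trace, Matrix.mul_apply, sq]

lemma aux_frob_conj {p : ℕ} (Q N : Matrix (Fin p) (Fin p) ℝ) (hQ : Q * Qᵀ = 1) :
    ((Q * N * Qᵀ) * (Q * N * Qᵀ)ᵀ).trace = (N * Nᵀ).trace := by
  have hQ' : Qᵀ * Q = 1 := mul_eq_one_comm.mp hQ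
  have : (Q * N * Qᵀ) * (Q * N * Qᵀ)ᵀ = Q * (N * Nᵀ * Qᵀ) := by
    simp only [Matrix.transpose_mul, Matrix.transpose_transpose]
    calc _ = Q * N * (Qᵀ * Q) * (Nᵀ * Qᵀ) := by simp only [Matrix.mul_assoc]
      _ = _ := by rw [hQ']; simp only [Matrix.mul_assoc, Matrix.one_mul]
  rw [this, Matrix.trace_mul_comm, Matrix.mul_assoc, hQ', Matrix.mul_one]

lemma aux_gamma {p : ℕ} {B : ℝ} {V P Q : Matrix (Fin p) (Fin p) ℝ} {d γ : Fin p → ℝ}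
    (hV : ∑ a, ∑ b, (V a b) ^ 2 = 1) (hP : P * Pᵀ = 1) (hd0 : ∀ i, 0 ≤ d i) (hd : ∀ i, d i ≤ B)
    (hQ : Q * Qᵀ = 1)
    (h : Matrix.diagonal (fun i => Real.sqrt (d i)) * Pᵀ * V * P *
        Matrix.diagonal (fun i => Real.sqrt (d i)) = Q * Matrix.diagonal γ * Qᵀ) :
    ∑ j, γ j ^ 2 ≤ B ^ 2 := by
  have hP' : Pᵀ * P = 1 := mul_eq_one_comm.mp hP
  have e1 : ∑ j, γ j ^ 2 = (Matrix.diagonal γ * (Matrix.diagonal γ)ᵀ).trace := by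
    rw [Matrix.diagonal_transpose, Matrix.diagonal_mul_diagonal, Matrix.trace_diagonal]
    simp [sq]
  rw [e1, ← aux_frob_conj Q _ hQ, ← h, aux_frob]
  set W := Pᵀ * V * P with hW
  have hWf : ∑ a, ∑ b, (W a b) ^ 2 = 1 := by
    have := aux_frob_conj Pᵀ V (by simpa using hP')
    rw [Matrix.transpose_transpose] at this
    rw [← aux_frob, hW, this, aux_frob, hV]
  have e2 : Matrix.diagonal (fun i => Real.sqrt (d i)) * Pᵀ * V * P *
        Matrix.diagonal (fun i => Real.sqrt (d i)) = Matrix.diagonal (fun i => Real.sqrt (d i)) * W *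
        Matrix.diagonal (fun i => Real.sqrt (d i)) := by
    simp only [hW, Matrix.mul_assoc]
  rw [e2]
  calc _ ≤ ∑ a, ∑ b, B ^ 2 * (W a b) ^ 2 := by
        apply Finset.sum_le_sum; intro a _
        apply Finset.sum_le_sum; intro b _
        rw [Matrix.mul_diagonal, Matrix.diagonal_mul, mul_pow, mul_pow, Real.sq_sqrt (hd0 a),
          Real.sq_sqrt (hd0 b)]
        calc _ = d a * d b * W a b ^ 2 := by ring
          _ ≤ B * B * W a b ^ 2 := by
            have := hd0 a
            have := hd0 b
            have := hd a
            have := hd b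
            have : 0 ≤ B := by linarith
            gcongr
          _ = _ := by ring
    _ = B ^ 2 * ∑ a, ∑ b, (W a b) ^ 2 := by simp only [Finset.mul_sum]
    _ = B ^ 2 := by rw [hWf, mul_one]

lemma aux_lin {p : ℕ} (b : Fin p → ℝ) :
    charFun (Measure.map (fun z : Fin p → ℝ => ∑ j, b j * z j)
      (Measure.pi fun _ : Fin p => gaussianReal 0 1)) 1 =
    charFun (gaussianReal 0 (Real.toNNReal (∑ j, b j ^ 2))) 1 := by
  rw [charFun_apply_real, integral_map (Measurable.aemeasurable (by fun_prop)) (by fun_prop), charFun_gaussianReal]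
  have : ∀ z : Fin p → ℝ, Complex.exp ((1 : ℝ) * ((∑ j, b j * z j : ℝ) : ℂ) * Complex.I) =
      ∏ j, Complex.exp ((b j : ℂ) * (z j : ℂ) * Complex.I) := by
    intro z
    rw [← Complex.exp_sum]
    congr 1
    push_cast
    rw [one_mul, Finset.sum_mul]
  simp_rw [this]
  rw [integral_fintype_prod_eq_prod (fun j (x : ℝ) => Complex.exp ((b j : ℂ) * (x : ℂ) * Complex.I))]
  simp_rw [← charFun_apply_real, charFun_gaussianReal]
  rw [← Complex.exp_sum, Real.coe_toNNReal _ (Finset.sum_nonneg fun j _ => sq_nonneg _)]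
  congr 1
  push_cast
  simp [Finset.sum_div, Finset.sum_neg_distrib]

lemma aux_law {p : ℕ} {Ω : Type} [MeasurableSpace Ω] (μ : Measure Ω) [IsProbabilityMeasure μ]
    (X : Ω → Fin p → ℝ) (S A : Matrix (Fin p) (Fin p) ℝ) (hX : IsGaussianVec μ X 0 S)
    (hA : A * Aᵀ = S) :
    Measure.map X μ = Measure.map (fun z => A *ᵥ z)
      (Measure.pi fun _ : Fin p => gaussianReal 0 1) := by
  obtain ⟨hXm, hX⟩ := hX
  have hAm : Measurable (fun z : Fin p → ℝ => A *ᵥ z) := by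
    apply Continuous.measurable
    fun_prop
  have := Measure.isProbabilityMeasure_map (μ := μ) hXm.aemeasurable
  have := Measure.isProbabilityMeasure_map
    (μ := Measure.pi fun _ : Fin p => gaussianReal 0 1) hAm.aemeasurable
  apply Measure.ext_of_charFunDual
  funext L
  set a : Fin p → ℝ := fun i => L (Pi.single i 1) with ha
  have hL : ∀ x, L x = ∑ i, a i * x i := by
    intro x
    conv_lhs => rw [pi_eq_sum_univ' x]
    simp [ha, mul_comm, Pi.single_apply]
  rw [charFunDual_eq_charFun_map_one, charFunDual_eq_charFun_map_one,
    Measure.map_map (by fun_prop) hXm, Measure.map_map (by fun_prop) hAm]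
  have e1 : L ∘ X = fun ω => ∑ i, a i * X ω i := by funext ω; exact hL _
  have e2 : (L ∘ fun z => A *ᵥ z) = fun z => ∑ j, (a ᵥ* A) j * z j := by
    funext z
    rw [Function.comp, hL]
    exact Matrix.dotProduct_mulVec a A z
  rw [e1, e2, hX, aux_lin]
  have e3 : ∑ i, ∑ j, a i * S i j * a j = ∑ j, (a ᵥ* A) j ^ 2 := by
    have h1 : ∑ i, ∑ j, a i * S i j * a j = a ⬝ᵥ (S *ᵥ a) := by
      simp [dotProduct, Matrix.mulVec, Finset.mul_sum, mul_assoc]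
    rw [h1, ← hA, ← Matrix.mulVec_mulVec, Matrix.dotProduct_mulVec, Matrix.mulVec_transpose]
    simp [dotProduct, sq]
  rw [e3]
  simp

lemma aux_quad {p : ℕ} (V : Matrix (Fin p) (Fin p) ℝ) (x : Fin p → ℝ) :
    ∑ a, ∑ b, V a b * x a * x b = x ⬝ᵥ (V *ᵥ x) := by
  simp only [dotProduct, Matrix.mulVec, Finset.mul_sum]
  exact Finset.sum_congr rfl fun a _ => Finset.sum_congr rfl fun b _ => by ring

/-- Lemma A.2: let `X ~ N_p(0, Σ)` with `Σ ∈ U_τ(q, c₀, M)`, `V` symmetric with `‖V‖_F = 1`,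
`Σ = P Λ Pᵀ` the eigendecomposition of `Σ` and `γ` the eigenvalues of
`S = Λ^{1/2} Pᵀ V P Λ^{1/2}` (packaged as `S = Q (diagonal γ) Qᵀ` for orthogonal `Q`).
Then `tr(V X Xᵀ)` is distributed as `∑ⱼ γⱼ Zⱼ²` with `Zⱼ` i.i.d. standard normal, and there
exist `K, δ > 0` depending only on `q, c₀, M` such that
`P[p^{−1/2}|tr(V X Xᵀ) − ∑ⱼ γⱼ| ≥ t] ≤ K e^{−δ t (1 + o(1))}` as `t → ∞`. -/
theorem stmt18 (q c0 M : ℝ) (hq0 : 0 ≤ q) (hq1 : q < 1) (hc0 : 0 < c0) (hM : 0 < M) :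
    ∃ K > (0 : ℝ), ∃ δ > (0 : ℝ),
      ∀ (p : ℕ), 0 < p →
        ∀ (S : Matrix (Fin p) (Fin p) ℝ), S.PosSemidef → memUtau q c0 M S →
          ∀ (Ω : Type) [MeasurableSpace Ω] (μ : Measure Ω) [IsProbabilityMeasure μ]
            (X : Ω → Fin p → ℝ), IsGaussianVec μ X 0 S →
          ∀ (V : Matrix (Fin p) (Fin p) ℝ), V.IsSymm → (∑ a, ∑ b, (V a b) ^ 2 = 1) →
          ∀ (P Qm : Matrix (Fin p) (Fin p) ℝ) (d γ : Fin p → ℝ),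
            P * Pᵀ = 1 → (∀ i, 0 ≤ d i) → S = P * Matrix.diagonal d * Pᵀ →
            Qm * Qmᵀ = 1 →
            Matrix.diagonal (fun i => Real.sqrt (d i)) * Pᵀ * V * P *
                Matrix.diagonal (fun i => Real.sqrt (d i))
              = Qm * Matrix.diagonal γ * Qmᵀ →
            (Measure.map (fun ω => ∑ a, ∑ b, V a b * X ω a * X ω b) μ
                = Measure.map (fun z : Fin p → ℝ => ∑ j, γ j * (z j) ^ 2)
                    (Measure.pi fun _ : Fin p => gaussianReal 0 1)) ∧
            (∀ ε > (0 : ℝ), ∃ t₀ : ℝ, ∀ t ≥ t₀,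
              μ {ω | t ≤ |∑ a, ∑ b, V a b * X ω a * X ω b - ∑ j, γ j| / Real.sqrt p}
                ≤ ENNReal.ofReal (K * Real.exp (-δ * t * (1 - ε)))) := by
  have hB : 0 < M ^ (1 - q) * c0 := by positivity
  refine ⟨2 * Real.exp 1, by positivity, 1 / (4 * (M ^ (1 - q) * c0)), by positivity, ?_⟩
  intro p hp S hS hU Ω _ μ _ X hX V hVs hV P Qm d γ hP hd0 hSP hQ hN
  have hP' : Pᵀ * P = 1 := mul_eq_one_comm.mp hP
  have hQ' : Qmᵀ * Qm = 1 := mul_eq_one_comm.mp hQ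
  have hγ : ∑ j, γ j ^ 2 ≤ (M ^ (1 - q) * c0) ^ 2 :=
    aux_gamma hV hP hd0 (aux_eig (aux_rowsum hq1 hS hU) hP hSP) hQ hN
  set D := Matrix.diagonal (fun i => Real.sqrt (d i)) with hD
  have hDD : D * D = Matrix.diagonal d := by
    rw [hD, Matrix.diagonal_mul_diagonal]
    congr 1
    funext i
    exact Real.mul_self_sqrt (hd0 i)
  have hDt : Dᵀ = D := Matrix.diagonal_transpose _
  have hAA : (P * D * Qm) * (P * D * Qm)ᵀ = S := by
    rw [hSP, ← hDD]
    simp only [Matrix.transpose_mul, hDt]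
    calc _ = P * D * (Qm * Qmᵀ) * (D * Pᵀ) := by simp only [Matrix.mul_assoc]
      _ = _ := by rw [hQ]; simp only [Matrix.mul_assoc, Matrix.one_mul]
  have hAVA : (P * D * Qm)ᵀ * V * (P * D * Qm) = Matrix.diagonal γ := by
    simp only [Matrix.transpose_mul, hDt]
    calc _ = Qmᵀ * (D * Pᵀ * V * P * D) * Qm := by simp only [Matrix.mul_assoc]
      _ = (Qmᵀ * Qm) * Matrix.diagonal γ * (Qmᵀ * Qm) := by rw [hN]; simp only [Matrix.mul_assoc]
      _ = _ := by rw [hQ', Matrix.one_mul, Matrix.mul_one]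
  have hlaw := aux_law μ X S (P * D * Qm) hX hAA
  have hXm := hX.1
  have hAm : Measurable (fun z : Fin p → ℝ => (P * D * Qm) *ᵥ z) := by
    apply Continuous.measurable
    fun_prop
  have hfm : Measurable (fun x : Fin p → ℝ => ∑ a, ∑ b, V a b * x a * x b) := by fun_prop
  have hmap : Measure.map (fun ω => ∑ a, ∑ b, V a b * X ω a * X ω b) μ
      = Measure.map (fun z : Fin p → ℝ => ∑ j, γ j * (z j) ^ 2)
          (Measure.pi fun _ : Fin p => gaussianReal 0 1) := by
    have h1 := Measure.map_map (μ := μ) hfm hXm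
    have h2 := Measure.map_map (μ := Measure.pi fun _ : Fin p => gaussianReal 0 1) hfm hAm
    rw [hlaw, h2] at h1
    refine h1.symm.trans ?_
    congr 1
    funext z
    simp only [Function.comp]
    rw [aux_quad, Matrix.mulVec_mulVec, ← Matrix.vecMul_transpose (P * D * Qm) z,
      ← Matrix.dotProduct_mulVec, Matrix.mulVec_mulVec, ← Matrix.mul_assoc, hAVA]
    simp only [dotProduct, Matrix.mulVec_diagonal]
    exact Finset.sum_congr rfl fun j _ => by ring
  refine ⟨hmap, fun ε hε => ⟨0, fun t ht => ?_⟩⟩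
  have hp1 : (1 : ℝ) ≤ Real.sqrt p := by
    rw [Real.one_le_sqrt]
    exact_mod_cast hp
  have hms : MeasurableSet {y : ℝ | t * Real.sqrt p ≤ |y - ∑ j, γ j|} :=
    measurableSet_le measurable_const (by fun_prop)
  have hset : {ω | t ≤ |∑ a, ∑ b, V a b * X ω a * X ω b - ∑ j, γ j| / Real.sqrt p} =
      (fun ω => ∑ a, ∑ b, V a b * X ω a * X ω b) ⁻¹'
        {y : ℝ | t * Real.sqrt p ≤ |y - ∑ j, γ j|} := by
    ext ω
    simp only [Set.mem_ofPred_eq, Set.mem_preimage]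
    rw [le_div_iff₀ (by linarith)]
  rw [hset, ← Measure.map_apply (by fun_prop) hms, hmap, Measure.map_apply (by fun_prop) hms]
  refine (aux_tail γ hB hγ (t * Real.sqrt p)).trans ?_
  apply ENNReal.ofReal_le_ofReal
  gcongr ?_ * Real.exp ?_
  have hδ : 0 < 1 / (4 * (M ^ (1 - q) * c0)) := by positivity
  have h1 : t * (1 - ε) ≤ t * Real.sqrt p := by
    apply mul_le_mul_of_nonneg_left _ ht
    linarith
  have h2 := mul_le_mul_of_nonneg_left h1 hδ.le
  linarith
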